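/- arXiv:2512.20598 — 2 statements merged into one kernel-verified Lean document; each statement's English description precedes it below -/
import Mathlib

section
/- Let Σ = {s_0 < s_1 < ... < s_{σ-1}} be an ordered alphabet of size σ ≥ 1 and let K = s_{σ-1}^{k_{σ-1}} ... s_1^{k_1} s_0^{k_0} be a clustered string with all exponents k_i ≥ 2. Then the number of super-maximal extensions of K$ is exactly 2σ; equivalently, the size χ of a smallest suffixient set for K$ equals 2σ. -/
/-- The Burrows–Wheeler transform of `w`: last characters of all cyclic
rotations of `w`, listed in lexicographic order of the rotations. -/
def bwtL {α : Type*} [LinearOrder α] (w : List α) : List α :=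
  (List.insertionSort (· ≤ ·)
    ((List.range w.length).map (fun i => w.rotate i))).filterMap List.getLast?

/-- Number of runs (maximal equal-letter substrings) of a string. -/
def runsCount {α : Type*} [DecidableEq α] (l : List α) : ℕ :=
  (l.destutter (· ≠ ·)).length

/-- Terminate a string with the sentinel `⊥ = $`, smaller than every symbol. -/
def term {α : Type*} (w : List α) : List (WithBot α) :=
  w.map (fun a => (a : WithBot α)) ++ [⊥]

/-- `y` is a right-extension of `v`: `y = x ++ [a]` occurs in `v` where `x`
is right-maximal (some `x ++ [b]` with `b ≠ a` also occurs in `v`). -/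
def RightExt {α : Type*} (v y : List α) : Prop :=
  ∃ x a b, y = x ++ [a] ∧ a ≠ b ∧ (x ++ [a]) <:+: v ∧ (x ++ [b]) <:+: v

/-- `y` is a super-maximal extension of `v`: a right-extension that is not a
proper suffix of any other right-extension. -/
def SuperMax {α : Type*} (v y : List α) : Prop :=
  RightExt v y ∧ ∀ z, RightExt v z → y <:+ z → z = y

/-- Number of super-maximal extensions of `v`. -/
noncomputable def sre {α : Type*} (v : List α) : ℕ :=
  Set.ncard {y | SuperMax v y}

/-- χ(w): the size of a smallest suffixient set of `w$`, which equals the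
number of super-maximal extensions of `w$`. -/
noncomputable def chi {α : Type*} (w : List α) : ℕ :=
  sre (term w)

/-- The clustered string `s_{σ-1}^{k_{σ-1}} ⋯ s_1^{k_1} s_0^{k_0}`. -/
def clustered {α : Type*} {σ : ℕ} (s : Fin σ → α) (k : Fin σ → ℕ) : List α :=
  (List.finRange σ).reverse.flatMap (fun j => List.replicate (k j) (s j))

theorem occ_block {β : Type*} (a : β) (n : ℕ) (w z : List β) :
    z <:+: List.replicate n a ++ w ↔
      z <:+: w ∨ ∃ i p, 1 ≤ i ∧ i ≤ n ∧ p <+: w ∧ z = List.replicate i a ++ p := by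
  induction n with
  | zero =>
    constructor
    · intro h; left; simpa using h
    · rintro (h | ⟨i, p, h1, h2, -⟩)
      · simpa using h
      · omega
  | succ n ih =>
    rw [List.replicate_succ, List.cons_append, List.infix_cons_iff, ih]
    constructor
    · rintro (h | h | ⟨i, p, h1, h2, h3, h4⟩)
      · rw [← List.cons_append, ← List.replicate_succ] at h
        have h' : z <+: List.replicate (n + 1) a ∨
            ∃ p, z = List.replicate (n + 1) a ++ p ∧ p <+: w := by
          obtain ⟨u, hu⟩ := h
          rcases List.append_eq_append_iff.1 hu with ⟨c, h1, h2⟩ | ⟨c, h1, h2⟩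
          · exact Or.inl ⟨c, h1.symm⟩
          · exact Or.inr ⟨c, h1, ⟨u, h2.symm⟩⟩
        clear h
        rcases h' with h | ⟨p, rfl, hp⟩
        · rw [List.prefix_replicate_iff] at h
          obtain ⟨hl, hz⟩ := h
          rcases Nat.eq_zero_or_pos z.length with h0 | h0
          · left
            rw [List.length_eq_zero_iff] at h0
            subst h0; exact ⟨[], w, rfl⟩
          · right
            exact ⟨z.length, [], h0, hl, ⟨_, rfl⟩, by simpa using hz⟩
        · right
          exact ⟨n + 1, p, by omega, le_rfl, hp, rfl⟩
      · exact Or.inl h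
      · exact Or.inr ⟨i, p, h1, by omega, h3, h4⟩
    · rintro (h | ⟨i, p, h1, h2, h3, h4⟩)
      · exact Or.inr (Or.inl h)
      · rcases Nat.lt_or_ge n i with hi | hi
        · left
          have : i = n + 1 := by omega
          subst this
          subst h4
          rw [← List.cons_append, ← List.replicate_succ]
          exact (List.prefix_append_right_inj _).2 h3
        · exact Or.inr (Or.inr ⟨i, p, h1, hi, h3, h4⟩)

theorem rep_append_inj {β : Type*} {a : β} {i j : ℕ} {p q : List β}
    (hp : a ∉ p) (hq : a ∉ q)
    (h : List.replicate i a ++ p = List.replicate j a ++ q) : i = j ∧ p = q := by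
  classical
  have hc := congrArg (List.count a) h
  simp only [List.count_append, List.count_replicate_self,
    List.count_eq_zero_of_not_mem hp, List.count_eq_zero_of_not_mem hq, Nat.add_zero] at hc
  subst hc
  exact ⟨rfl, List.append_cancel_left h⟩

theorem rightExt_block {β : Type*} (a t : β) (n : ℕ) (w : List β)
    (ha : a ∉ t :: w) (y : List β) :
    RightExt (List.replicate n a ++ t :: w) y → 
      RightExt (t :: w) y ∨ (∃ i, i < n ∧ y = List.replicate (i + 1) a) ∨
        (∃ i, i < n ∧ y = List.replicate i a ++ [t]) := by
  rintro ⟨x, c, d, rfl, hcd, h1, h2⟩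
  have hat : a ≠ t := fun h => ha (by simp [h])
  rw [occ_block] at h1 h2
  rcases h1 with h1 | ⟨i, p, hi1, hin, hp, hx⟩
  · rcases h2 with h2 | ⟨j, q, hj1, hjn, hq, hx'⟩
    · exact Or.inl ⟨x, c, d, rfl, hcd, h1, h2⟩
    · have hax : a ∉ x := fun h => ha (h1.subset (by simp [h]))
      have hx0 : x = [] := by
        cases x with
        | nil => rfl
        | cons e x =>
          exfalso
          obtain ⟨j, rfl⟩ : ∃ j', j = j' + 1 := ⟨j - 1, by omega⟩
          simp only [List.replicate_succ, List.cons_append, List.cons.injEq] at hx'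
          exact hax (by simp [hx'.1])
      subst hx0
      by_cases hct : c = t
      · subst hct
        exact Or.inr (Or.inr ⟨0, by omega, by simp⟩)
      · exact Or.inl ⟨[], c, t, rfl, hct, h1, ⟨[], w, by simp⟩⟩
  · have hap : a ∉ p := fun h => ha (hp.subset h)
    rcases List.eq_nil_or_concat p with rfl | ⟨q, e, rfl⟩
    · obtain ⟨i, rfl⟩ : ∃ j', i = j' + 1 := ⟨i - 1, by omega⟩
      exact Or.inr (Or.inl ⟨i, by omega, by simpa using hx⟩)
    · rw [List.concat_eq_append] at *
      rw [← List.append_assoc] at hx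
      obtain ⟨rfl, hce⟩ := List.append_inj' hx rfl
      obtain rfl : c = e := by simpa using hce
      have haq : a ∉ q := fun h => hap (by simp [h])
      rcases h2 with h2 | ⟨j, r, hj1, hjn, hr, hx'⟩
      · exfalso
        refine ha (h2.subset ?_)
        simp; omega
      · have har : a ∉ r := fun h => ha (hr.subset h)
        by_cases hda : d = a
        · -- then the second word is a power of `a`
          subst hda
          have hr0 : r = [] := by
            rcases List.eq_nil_or_concat r with rfl | ⟨r', e, rfl⟩
            · rfl
            · exfalso
              rw [List.concat_eq_append, ← List.append_assoc] at hx'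
              have := (List.append_inj' hx' rfl).2
              exact har (by simp at this; simp [this])
          subst hr0
          have hq0 : q = [] := by
            rcases q with _ | ⟨e, q⟩
            · rfl
            · exfalso
              have : e ∈ List.replicate j d ++ [] := by rw [← hx']; simp
              simp at this
              exact haq (by simp [this.2])
          subst hq0
          have hlen := congrArg List.length hx'
          simp at hlen
          obtain ⟨u, hu⟩ := hp
          simp at hu
          exact Or.inr (Or.inr ⟨i, by omega, by simp [hu.1]⟩)
        · exfalso
          rw [List.append_assoc] at hx'
          have hqd : a ∉ q ++ [d] := by
            simp only [List.mem_append, List.mem_singleton, not_or]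
            exact ⟨haq, fun h => hda h.symm⟩
          obtain ⟨-, rfl⟩ := rep_append_inj hqd har hx'
          have h3 := List.prefix_of_prefix_length_le hp hr (by simp)
          have := h3.eq_of_length (by simp)
          simp at this
          exact hcd this

theorem rightExt_block_iff {β : Type*} (a t : β) (n : ℕ) (w : List β)
    (ha : a ∉ t :: w) (y : List β) :
    RightExt (List.replicate n a ++ t :: w) y ↔
      RightExt (t :: w) y ∨ (∃ i, i < n ∧ y = List.replicate (i + 1) a) ∨
        (∃ i, i < n ∧ y = List.replicate i a ++ [t]) := by
  have hat : a ≠ t := fun h => ha (by simp [h])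
  have key1 : ∀ i, i < n → List.replicate i a ++ [a] <:+: List.replicate n a ++ t :: w := by
    intro i hi
    rw [occ_block]
    exact Or.inr ⟨i + 1, [], by omega, by omega, ⟨_, rfl⟩, by simp [List.replicate_succ']⟩
  have key2 : ∀ i, i < n → List.replicate i a ++ [t] <:+: List.replicate n a ++ t :: w := by
    intro i hi
    rw [occ_block]
    rcases Nat.eq_zero_or_pos i with rfl | h0
    · exact Or.inl ⟨[], w, by simp⟩
    · exact Or.inr ⟨i, [t], h0, by omega, ⟨w, by simp⟩, rfl⟩
  refine ⟨rightExt_block a t n w ha y, ?_⟩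
  rintro (⟨x, c, d, rfl, hcd, h1, h2⟩ | ⟨i, hi, rfl⟩ | ⟨i, hi, rfl⟩)
  · have hs := (List.suffix_append (List.replicate n a) (t :: w)).isInfix
    exact ⟨x, c, d, rfl, hcd, h1.trans hs, h2.trans hs⟩
  · exact ⟨List.replicate i a, a, t, List.replicate_succ', hat, key1 i hi, key2 i hi⟩
  · exact ⟨List.replicate i a, t, a, rfl, hat.symm, key2 i hi, key1 i hi⟩

theorem RightExt.occurs {β : Type*} {v y : List β} (h : RightExt v y) : y <:+: v := by
  obtain ⟨x, c, d, rfl, -, h1, -⟩ := h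
  exact h1

theorem RightExt.ne_nil {β : Type*} {v y : List β} (h : RightExt v y) : y ≠ [] := by
  obtain ⟨x, c, d, rfl, -, h1, -⟩ := h
  simp

theorem superMax_block {β : Type*} (a t : β) (n : ℕ) (hn : 2 ≤ n) (w : List β)
    (ha : a ∉ t :: w) (ht : ¬ SuperMax (t :: w) [t]) (y : List β) :
    SuperMax (List.replicate n a ++ t :: w) y ↔
      SuperMax (t :: w) y ∨ y = List.replicate n a ∨ y = List.replicate (n - 1) a ++ [t] := by
  have hat : a ≠ t := fun h => ha (by simp [h])
  have hE := rightExt_block_iff a t n w ha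
  have hna : ∀ z, RightExt (t :: w) z → a ∉ z := fun z hz h => ha (hz.occurs.subset h)
  constructor
  · rintro ⟨h1, h2⟩
    rcases (hE y).1 h1 with h | ⟨i, hi, rfl⟩ | ⟨i, hi, rfl⟩
    · exact Or.inl ⟨h, fun z hz hyz => h2 z ((hE z).2 (Or.inl hz)) hyz⟩
    · right; left
      have := h2 (List.replicate n a) ((hE _).2 (Or.inr (Or.inl ⟨n - 1, by omega, by
        congr 1; omega⟩))) ⟨List.replicate (n - (i + 1)) a, by
          rw [List.replicate_append_replicate]; congr 1; omega⟩
      exact this.symm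
    · right; right
      have := h2 (List.replicate (n - 1) a ++ [t]) ((hE _).2 (Or.inr (Or.inr ⟨n - 1, by omega, rfl⟩)))
        ⟨List.replicate (n - 1 - i) a, by
          rw [← List.append_assoc, List.replicate_append_replicate]; congr 2; omega⟩
      exact this.symm
  · rintro (⟨h1, h2⟩ | rfl | rfl)
    · refine ⟨(hE y).2 (Or.inl h1), fun z hz hyz => ?_⟩
      rcases (hE z).1 hz with h | ⟨i, hi, rfl⟩ | ⟨i, hi, rfl⟩
      · exact h2 z h hyz
      · exfalso
        obtain ⟨e, he⟩ := List.exists_mem_of_ne_nil y h1.ne_nil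
        have := List.eq_of_mem_replicate (hyz.subset he)
        exact hna y h1 (this ▸ he)
      · exfalso
        obtain ⟨x, c, d, rfl, -⟩ := id h1
        obtain ⟨u, hu⟩ := hyz
        rw [← List.append_assoc] at hu
        obtain ⟨hu1, hu2⟩ := List.append_inj' hu rfl
        have hct : c = t := by simpa using hu2
        subst hct
        have hx0 : x = [] := by
          rcases x with _ | ⟨e, x⟩
          · rfl
          · exfalso
            have : e ∈ List.replicate i a := by rw [← hu1]; simp
            have := List.eq_of_mem_replicate this
            exact hna _ h1 (by simp [this])
        subst hx0
        exact ht ⟨h1, h2⟩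
    · refine ⟨(hE _).2 (Or.inr (Or.inl ⟨n - 1, by omega, by congr 1; omega⟩)), fun z hz hyz => ?_⟩
      have haz : a ∈ List.replicate n a := by simp; omega
      rcases (hE z).1 hz with h | ⟨i, hi, rfl⟩ | ⟨i, hi, rfl⟩
      · exact absurd (hyz.subset haz) (hna z h)
      · have := hyz.length_le
        simp at this
        congr 1; omega
      · exfalso
        obtain ⟨u, hu⟩ := hyz
        obtain ⟨m, rfl⟩ : ∃ m, n = m + 1 := ⟨n - 1, by omega⟩
        rw [List.replicate_succ', ← List.append_assoc] at hu
        have := (List.append_inj' hu rfl).2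
        exact hat (by simpa using this)
    · refine ⟨(hE _).2 (Or.inr (Or.inr ⟨n - 1, by omega, rfl⟩)), fun z hz hyz => ?_⟩
      have haz : a ∈ List.replicate (n - 1) a ++ [t] := by simp; omega
      rcases (hE z).1 hz with h | ⟨i, hi, rfl⟩ | ⟨i, hi, rfl⟩
      · exact absurd (hyz.subset haz) (hna z h)
      · exfalso
        have : t ∈ List.replicate (i + 1) a := hyz.subset (by simp)
        exact hat (List.eq_of_mem_replicate this).symm
      · have := hyz.length_le
        simp at this
        congr 2; omega

theorem term_eq {α : Type*} (w : List α) :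
    term w = List.map (WithBot.some) w ++ [⊥] := by
  induction w with
  | nil => rfl
  | cons a w ih =>
    have : term (a :: w) = (a : WithBot α) :: term w := rfl
    rw [this, ih]; rfl

theorem count_blocks {α : Type*} {σ : ℕ} (s : Fin σ → α) (hs : Function.Injective s)
    (k : Fin σ → ℕ) (hk : ∀ j, 2 ≤ k j) (l : List (Fin σ)) (hl : l.Nodup) :
    ∃ t w, term (l.flatMap (fun j => List.replicate (k j) (s j))) = t :: w ∧
      ¬ SuperMax (t :: w) [t] ∧ {y | SuperMax (t :: w) y}.Finite ∧
      {y | SuperMax (t :: w) y}.ncard = 2 * l.length := by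
  induction l with
  | nil =>
    have h0 : ∀ y, ¬ SuperMax [(⊥ : WithBot α)] y := by
      rintro y ⟨⟨x, c, d, -, hcd, h1, h2⟩, -⟩
      have hc : c = ⊥ := by simpa using h1.subset (show c ∈ x ++ [c] by simp)
      have hd : d = ⊥ := by simpa using h2.subset (show d ∈ x ++ [d] by simp)
      exact hcd (hc.trans hd.symm)
    refine ⟨⊥, [], by simp [term], h0 _, ?_, ?_⟩ <;> simp [h0]
  | cons j l ih =>
    rw [List.nodup_cons] at hl
    obtain ⟨t, w, hv, ht, hf, hc⟩ := ih hl.2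
    have hn := hk j
    have hv' : term ((j :: l).flatMap (fun j => List.replicate (k j) (s j)))
        = List.replicate (k j) (s j : WithBot α) ++ t :: w := by
      rw [← hv, term_eq, term_eq]; simp
    have ha : (s j : WithBot α) ∉ t :: w := by
      rw [← hv, term_eq]
      simp only [List.mem_append, List.mem_map, List.mem_flatMap, List.mem_singleton]
      rintro (⟨b, ⟨j', hj', hb⟩, hbs⟩ | h)
      · have h1 := List.eq_of_mem_replicate hb
        have h2 : b = s j := by simpa using hbs
        have := hs (h1.symm.trans h2)
        exact hl.1 (this ▸ hj')
      · simp at h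
    generalize (s j : WithBot α) = a at *
    generalize k j = n at *
    have hE := rightExt_block_iff a t n w ha
    have hS := superMax_block a t n hn w ha ht
    have hat : a ≠ t := fun h => ha (by simp [h])
    have e : List.replicate n a ++ t :: w = a :: (List.replicate (n - 1) a ++ t :: w) := by
      rw [← List.cons_append, ← List.replicate_succ]; congr 2; omega
    have n1 : List.replicate (n - 1) a ++ [t] ∉ {y | SuperMax (t :: w) y} := by
      intro h
      exact ha (h.1.occurs.subset (by simp; omega))
    have n2 : List.replicate n a ∉
        insert (List.replicate (n - 1) a ++ [t]) {y | SuperMax (t :: w) y} := by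
      rintro (h | h)
      · have : t ∈ List.replicate n a := by rw [h]; simp
        exact hat (List.eq_of_mem_replicate this).symm
      · exact ha (h.1.occurs.subset (by simp; omega))
    have hset : {y | SuperMax (List.replicate n a ++ t :: w) y} =
        insert (List.replicate n a) (insert (List.replicate (n - 1) a ++ [t])
          {y | SuperMax (t :: w) y}) := by
      ext y
      simp only [Set.mem_ofPred_eq, Set.mem_insert_iff, hS]
      tauto
    refine ⟨a, List.replicate (n - 1) a ++ t :: w, hv'.trans e, ?_, ?_, ?_⟩
    · rw [← e]
      rintro ⟨-, h⟩
      have := h (List.replicate n a) ((hE _).2 (Or.inr (Or.inl ⟨n - 1, by omega, by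
        congr 1; omega⟩))) ⟨List.replicate (n - 1) a, by
          rw [← List.replicate_succ']; congr 1; omega⟩
      have := congrArg List.length this
      simp at this
      omega
    · rw [← e, hset]
      exact (hf.insert _).insert _
    · rw [← e, hset, Set.ncard_insert_of_notMem n2 (hf.insert _),
        Set.ncard_insert_of_notMem n1 hf, hc, List.length_cons]
      ring

/-- the number of super-maximal extensions of the terminated
clustered string (equivalently, the size χ of a smallest suffixient set)
is exactly 2σ. -/
theorem clustered_chi {α : Type*} [LinearOrder α] (σ : ℕ) (hσ : 1 ≤ σ)
    (s : Fin σ → α) (hs : StrictMono s)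
    (k : Fin σ → ℕ) (hk : ∀ j, 2 ≤ k j) :
    chi (clustered s k) = 2 * σ := by
  obtain ⟨t, w, hv, -, -, hc⟩ := count_blocks s hs.injective k hk (List.finRange σ).reverse
    (List.nodup_reverse.2 (List.nodup_finRange σ))
  unfold chi sre clustered
  rw [hv, hc]
  simp
end

section
/- For every σ ≥ 1 and every clustered string K over an ordered alphabet of size σ with all block exponents at least 2, the ratio χ(K)/r(K) equals 2σ/(σ+1); consequently, the sequence of ratios χ/r over the clustered family tends to 2 as the alphabet size σ tends to infinity. -/
section Aux
variable {β : Type*} [LinearOrder β]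

theorem aux_lex (a : β) (X Y : List β) : ∀ l : List β, (∀ b ∈ l, b ≤ a) → (∃ b ∈ l, b < a) →
    l ++ X < a :: (l ++ Y) := by
  intro l
  induction l with
  | nil => rintro _ ⟨b, hb, _⟩; simp at hb
  | cons c l ih =>
    intro h1 h2
    rcases lt_or_eq_of_le (h1 c (by simp)) with h | h
    · exact List.Lex.rel h
    · subst h
      apply List.Lex.cons
      apply ih
      · intro b hb; exact h1 b (by simp [hb])
      · obtain ⟨b, hb, hlt⟩ := h2
        rcases List.mem_cons.1 hb with rfl | hb
        · exact absurd hlt (lt_irrefl _)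
        · exact ⟨b, hb, hlt⟩

theorem aux_rot (u : List β) (z : β) (hz : ∀ a ∈ u, z < a) (hu : u.Pairwise (· ≥ ·)) (i : ℕ)
    (hi : i < u.length) : (u ++ [z]).rotate (i+1) ≤ (u ++ [z]).rotate i := by
  apply le_of_lt
  rw [List.rotate_eq_drop_append_take (by simp; omega), List.rotate_eq_drop_append_take (by simp; omega)]
  have hv : (u ++ [z]).Pairwise (· ≥ ·) := by
    rw [List.pairwise_append]
    refine ⟨hu, by simp, ?_⟩
    intro a ha b hb
    simp at hb; subst hb; exact (hz a ha).le
  have hi' : i < (u ++ [z]).length := by simp; omega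
  rw [List.drop_eq_getElem_cons hi']
  have hd := hv.sublist (List.drop_sublist i _)
  rw [List.drop_eq_getElem_cons hi', List.pairwise_cons] at hd
  rw [List.cons_append]
  apply aux_lex
  · intro b hb; exact hd.1 b hb
  · refine ⟨z, ?_, ?_⟩
    · rw [List.drop_append_of_le_length (by omega)]; simp
    · rw [List.getElem_append_left hi]; exact hz _ (List.getElem_mem _)

theorem aux_bwt (u : List β) (z : β) (hz : ∀ a ∈ u, z < a) (hu : u.Pairwise (· ≥ ·)) :
    bwtL (u ++ [z]) = u.reverse ++ [z] := by
  unfold bwtL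
  have hp : ((List.range (u ++ [z]).length).map (fun i => (u ++ [z]).rotate i)).Pairwise
      (fun x y => y ≤ x) := by
    rw [← List.isChain_iff_pairwise, List.isChain_iff_getElem]
    intro i hi
    simp at hi
    simp only [List.getElem_map, List.getElem_range]
    exact aux_rot u z hz hu i (by omega)
  have hs : List.insertionSort (· ≤ ·) ((List.range (u ++ [z]).length).map
      (fun i => (u ++ [z]).rotate i)) = ((List.range (u ++ [z]).length).map
      (fun i => (u ++ [z]).rotate i)).reverse := by
    apply List.Perm.eq_of_pairwise (le := (· ≤ ·))
    · intro a b _ _ h1 h2; exact le_antisymm h1 h2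
    · exact List.pairwise_insertionSort _ _
    · rw [List.pairwise_reverse]; exact hp
    · exact (List.perm_insertionSort _ _).trans (List.reverse_perm _).symm
  rw [hs, List.filterMap_reverse]
  have hm : ((List.range (u ++ [z]).length).map (fun i => (u ++ [z]).rotate i)).map List.getLast?
      = (z :: u).map some := by
    apply List.ext_getElem
    · simp
    · intro i h1 h2
      simp only [List.getElem_map, List.getElem_range]
      simp at h1
      rw [List.rotate_eq_drop_append_take (by simp; omega)]
      rcases i with _ | i
      · simp
      · have hi : i < u.length := by omega
        rw [List.take_succ_eq_append_getElem (by simp; omega), ← List.append_assoc, List.getLast?_append]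
        simp [List.getElem_append_left hi]
  have : List.filterMap List.getLast? ((List.range (u ++ [z]).length).map
      (fun i => (u ++ [z]).rotate i)) = z :: u := by
    have h2 := congrArg (List.filterMap id) hm
    rw [List.filterMap_map, List.filterMap_map] at h2
    simpa using h2
  rw [this]; simp

theorem aux_destutter_rep (a : β) (n : ℕ) (r : List β) :
    List.destutter' (· ≠ ·) a (List.replicate n a ++ r) = List.destutter' (· ≠ ·) a r := by
  induction n with
  | zero => simp
  | succ n ih => rw [List.replicate_succ, List.cons_append, List.destutter'_cons_neg _ (by simp), ih]

theorem aux_destutter {ι : Type*} (s : ι → β) (k : ι → ℕ) (z : β) (hk : ∀ j, 1 ≤ k j) :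
    ∀ (js : List ι) (a : β), (a :: (js.map s ++ [z])).IsChain (· ≠ ·) →
    List.destutter' (· ≠ ·) a (js.flatMap (fun j => List.replicate (k j) (s j)) ++ [z])
      = a :: (js.map s ++ [z]) := by
  intro js
  induction js with
  | nil => intro a h; simp at h; simp [List.destutter', h]
  | cons j js ih =>
    intro a h
    obtain ⟨n, hn⟩ : ∃ n, k j = n + 1 := ⟨k j - 1, by have := hk j; omega⟩
    simp only [List.map_cons, List.cons_append, List.isChain_cons_cons] at h
    rw [List.flatMap_cons, hn, List.replicate_succ, List.cons_append, List.cons_append,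
      List.destutter'_cons_pos _ h.1, List.append_assoc, aux_destutter_rep, ih _ h.2]
    simp

theorem aux_decomp (c : β) (v : List β) (hv : v.Pairwise (· ≥ ·)) :
    v = v.filter (c < ·) ++ (List.replicate (v.count c) c ++ v.filter (· < c)) := by
  induction v with
  | nil => simp
  | cons a v ih =>
    rw [List.pairwise_cons] at hv
    have := ih hv.2
    rcases lt_trichotomy a c with h | h | h
    · have h1 : v.filter (c < ·) = [] := by
        rw [List.filter_eq_nil_iff]; intro b hb; simpa using (hv.1 b hb).trans h.le
      have h2 : v.count c = 0 := by
        rw [List.count_eq_zero]; intro hb; exact absurd (hv.1 c hb) (not_le.2 h)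
      rw [h1, h2] at this
      rw [List.filter_cons_of_neg (by simpa using h.le), h1, List.count_cons_of_ne h.ne, h2,
        List.filter_cons_of_pos (by simpa using h)]
      simpa using this
    · subst h
      have h1 : v.filter (a < ·) = [] := by
        rw [List.filter_eq_nil_iff]; intro b hb; simpa using (hv.1 b hb)
      rw [h1] at this
      rw [List.filter_cons_of_neg (by simp), h1, List.count_cons_self,
        List.filter_cons_of_neg (by simp), List.replicate_succ]
      simpa using this
    · rw [List.filter_cons_of_pos (by simpa using h), List.count_cons_of_ne h.ne',
        List.filter_cons_of_neg (by simpa using h.le), List.cons_append, ← this]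

theorem aux_occurs (c d : β) (v : List β) (hv : v.Pairwise (· ≥ ·)) (hd : d ∈ v) (hdc : d < c)
    (hcov : ∀ e ∈ v, e < c → e ≤ d) : (List.replicate (v.count c) c ++ [d]) <:+: v := by
  have h := aux_decomp c v hv
  have hm : d ∈ v.filter (· < c) := by simp [hd, hdc]
  have hp : (v.filter (· < c)).Pairwise (· ≥ ·) := hv.sublist List.filter_sublist
  have hall : ∀ e ∈ v.filter (· < c), e ≤ d := by
    intro e he; simp at he; exact hcov e he.1 he.2
  generalize v.filter (· < c) = f at *
  cases f with
  | nil => simp at hm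
  | cons e f =>
    have hed : e = d := by
      apply le_antisymm (hall e (by simp))
      rw [List.pairwise_cons] at hp
      rcases List.mem_cons.1 hm with rfl | hm
      · exact le_rfl
      · exact hp.1 d hm
    subst hed
    refine ⟨v.filter (c < ·), f, ?_⟩
    conv_rhs => rw [h]
    simp

/-- Structure of pairs of right extensions in a weakly decreasing word. -/
theorem aux_ext (v x : List β) (a b : β) (hv : v.Pairwise (· ≥ ·)) (hba : b < a)
    (ha : (x ++ [a]) <:+: v) (hb : (x ++ [b]) <:+: v) :
    x = List.replicate x.length a ∧ x.length + 1 ≤ v.count a ∧ b ∈ v ∧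
      (x ≠ [] → ∀ e ∈ v, e < a → e ≤ b) := by
  have hav : a ∈ v := ha.subset (by simp)
  have hbv : b ∈ v := hb.subset (by simp)
  have hxa : ∀ e ∈ x, a ≤ e := by
    have := hv.sublist ha.sublist
    rw [List.pairwise_append] at this
    intro e he; exact this.2.2 e he a (by simp)
  obtain ⟨p, q, hpq⟩ := hb
  have hw := hv
  rw [← hpq] at hw
  simp only [List.append_assoc, List.pairwise_append, List.mem_append, List.singleton_append,
    List.pairwise_cons, List.mem_cons] at hw
  obtain ⟨-, ⟨hx, ⟨hbq, -⟩, hxq⟩, hp⟩ := hw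
  have hacount : x.count a + 1 ≤ v.count a := by
    have := ha.sublist.count_le a
    simpa using this
  have hq0 : (b :: q).count a = 0 := by
    rw [List.count_eq_zero]
    intro h
    rcases List.mem_cons.1 h with h | h
    · exact hba.ne' h
    · exact absurd (hbq a h) (not_le.2 hba)
  have hcv : v.count a = p.count a + x.count a := by
    rw [← hpq, List.append_assoc, List.append_assoc, List.count_append, List.count_append,
      List.singleton_append, hq0]; omega
  have hap : a ∈ p := by
    rw [← List.count_pos_iff]; omega
  have hxe : ∀ e ∈ x, e = a := fun e he => le_antisymm (hp a hap e (Or.inl he)) (hxa e he)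
  have hxr : x = List.replicate x.length a := List.eq_replicate_of_mem hxe
  refine ⟨hxr, ?_, hbv, ?_⟩
  · have : x.count a = x.length := by rw [List.count_eq_length]; intro e he; exact (hxe e he).symm
    omega
  · intro hne e he hea
    rw [← hpq] at he
    simp only [List.append_assoc, List.mem_append, List.singleton_append, List.mem_cons] at he
    rcases he with he | he | he | he
    · exact absurd (hp e he a (by
        obtain ⟨y, hy⟩ := List.exists_mem_of_ne_nil x hne
        exact Or.inl (hxe y hy ▸ hy))) (not_le.2 hea)
    · exact absurd (hxe e he) hea.ne
    · exact he.le
    · exact hbq e he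

theorem aux_last2 (A B : List β) (c d c' d' : β) (h : (A ++ [c, d]) <:+ (B ++ [c', d'])) :
    c = c' ∧ d = d' := by
  obtain ⟨z, hz⟩ := h
  have h := congrArg List.reverse hz
  simp at h
  exact ⟨h.2.1, h.1⟩

theorem aux_sre (σ : ℕ) (hσ : 1 ≤ σ) (t : Fin (σ+1) → β) (ht : StrictMono t) (k : Fin σ → ℕ)
    (hk : ∀ j, 2 ≤ k j) (v : List β) (hv : v.Pairwise (· ≥ ·)) (hmem : ∀ e, e ∈ v ↔ ∃ i, e = t i)
    (hc : ∀ j, v.count (t j.succ) = k j) : sre v = 2 * σ := by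
  let f : Fin σ × Bool → List β := fun p =>
    List.replicate (k p.1 - 1) (t p.1.succ) ++ [if p.2 then t p.1.succ else t p.1.castSucc]
  have hf : ∀ p : Fin σ × Bool, f p = List.replicate (k p.1 - 2) (t p.1.succ) ++
      [t p.1.succ, if p.2 then t p.1.succ else t p.1.castSucc] := by
    intro p
    have := hk p.1
    obtain ⟨n, hn⟩ : ∃ n, k p.1 = n + 2 := ⟨k p.1 - 2, by omega⟩
    simp [f, hn, List.replicate_succ']
  have hft : ∀ j, f (j, true) = List.replicate (k j) (t j.succ) := by
    intro j
    have := hk j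
    obtain ⟨n, hn⟩ : ∃ n, k j = n + 2 := ⟨k j - 2, by omega⟩
    simp [f, hn, List.replicate_succ' (n := n + 1)]
  have hcov : ∀ j : Fin σ, ∀ e ∈ v, e < t j.succ → e ≤ t j.castSucc := by
    intro j e he hlt
    obtain ⟨i, rfl⟩ := (hmem e).1 he
    rw [ht.lt_iff_lt] at hlt
    rw [ht.le_iff_le]
    simp [Fin.lt_def, Fin.le_def] at *; omega
  have h3 : ∀ p q, f p <:+ f q → p = q := by
    rintro ⟨j, e⟩ ⟨i, e'⟩ h
    rw [hf, hf] at h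
    obtain ⟨h1, h2⟩ := aux_last2 _ _ _ _ _ _ h
    simp only [ht.injective.eq_iff, Fin.succ_inj] at h1
    subst h1
    have hne : t j.castSucc < t j.succ := ht (Fin.castSucc_lt_succ)
    cases e <;> cases e' <;> simp at h2 ⊢
    · exact hne.ne h2
    · exact hne.ne' h2
  have h2 : ∀ p, RightExt v (f p) := by
    rintro ⟨j, e⟩
    have hne : t j.castSucc < t j.succ := ht (Fin.castSucc_lt_succ)
    have hi := aux_occurs (t j.succ) (t j.castSucc) v hv ((hmem _).2 ⟨_, rfl⟩) hne (hcov j)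
    rw [hc] at hi
    have i1 : (List.replicate (k j - 1) (t j.succ) ++ [t j.succ]) <:+: v := by
      have := hft j
      simp only [f, if_true] at this
      rw [this]
      exact (List.prefix_append _ _).isInfix.trans hi
    have i2 : (List.replicate (k j - 1) (t j.succ) ++ [t j.castSucc]) <:+: v := by
      refine List.IsInfix.trans (List.IsSuffix.isInfix ?_) hi
      refine ⟨[t j.succ], ?_⟩
      obtain ⟨n, hn⟩ : ∃ n, k j = n + 1 := ⟨k j - 1, by have := hk j; omega⟩
      simp [hn, List.replicate_succ]
    cases e
    · exact ⟨_, _, t j.succ, by simp [f], hne.ne, i2, i1⟩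
    · exact ⟨_, _, t j.castSucc, by simp [f], hne.ne', i1, i2⟩
  have hhi : ∀ a b, a ∈ v → b ∈ v → b < a → ∃ j : Fin σ, a = t j.succ := by
    intro a b ha hb hlt
    obtain ⟨i, rfl⟩ := (hmem a).1 ha
    obtain ⟨i', rfl⟩ := (hmem b).1 hb
    rw [ht.lt_iff_lt] at hlt
    have : i ≠ 0 := by rintro rfl; exact absurd hlt (Fin.not_lt_zero _)
    exact ⟨i.pred this, by simp⟩
  have hrep : ∀ (m n : ℕ) (a : β), m ≤ n → List.replicate m a <:+ List.replicate n a := by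
    intro m n a h
    exact ⟨List.replicate (n - m) a, by rw [← List.replicate_add]; congr 1; omega⟩
  have h1 : ∀ y, RightExt v y → ∃ p, y <:+ f p := by
    rintro y ⟨x, a, b, rfl, hab, ha, hb⟩
    rcases lt_or_gt_of_ne hab with h | h
    · obtain ⟨g1, g2, g3, g4⟩ := aux_ext v x b a hv h hb ha
      obtain ⟨j, rfl⟩ := hhi b a (hb.subset (by simp)) g3 h
      rw [hc] at g2
      by_cases hx : x = []
      · subst hx
        obtain ⟨i, rfl⟩ := (hmem a).1 g3
        by_cases hi : i = 0
        · subst hi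
          exact ⟨(⟨0, hσ⟩, false), ⟨List.replicate (k ⟨0, hσ⟩ - 1) (t (Fin.succ ⟨0, hσ⟩)), by simp [f]⟩⟩
        · refine ⟨(i.pred hi, true), List.replicate (k (i.pred hi) - 1) (t i), by simp [f]⟩
      · have : a = t j.castSucc := by
          apply le_antisymm (hcov j a g3 h)
          exact g4 hx _ ((hmem _).2 ⟨_, rfl⟩) (ht Fin.castSucc_lt_succ)
        subst this
        refine ⟨(j, false), ?_⟩
        rw [g1]
        obtain ⟨r, hr⟩ := hrep x.length (k j - 1) (t j.succ) (by omega)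
        exact ⟨r, by simp [f, ← hr]⟩
    · obtain ⟨g1, g2, g3, g4⟩ := aux_ext v x a b hv h ha hb
      obtain ⟨j, rfl⟩ := hhi a b (ha.subset (by simp)) g3 h
      rw [hc] at g2
      refine ⟨(j, true), ?_⟩
      rw [hft, g1, ← List.replicate_succ']
      exact hrep _ _ _ g2
  have hset : {y | SuperMax v y} = Set.range f := by
    ext y
    constructor
    · rintro ⟨hy, hmax⟩
      obtain ⟨p, hp⟩ := h1 y hy
      exact ⟨p, hmax _ (h2 p) hp⟩
    · rintro ⟨p, rfl⟩
      refine ⟨h2 p, ?_⟩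
      intro z hz hs
      obtain ⟨q, hq⟩ := h1 z hz
      have := h3 p q (hs.trans hq)
      subst this
      exact hq.eq_of_length_le hs.length_le
  have hinj : Function.Injective f := fun p q h => h3 p q (h ▸ List.suffix_rfl)
  unfold sre
  rw [hset, ← Set.image_univ, Set.ncard_image_of_injective _ hinj, Set.ncard_univ]
  simp [mul_comm]

end Aux

theorem aux_term {α : Type*} (w : List α) : term w = w.map WithBot.some ++ [⊥] := by
  unfold term
  simp [← List.map_eq_flatMap]
  try rfl

theorem aux_mem {α : Type*} {σ : ℕ} (s : Fin σ → α) (k : Fin σ → ℕ) (hk : ∀ j, 2 ≤ k j) (a : α) :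
    a ∈ clustered s k ↔ ∃ j, a = s j := by
  unfold clustered
  simp only [List.mem_flatMap, List.mem_reverse, List.mem_finRange, true_and, List.mem_replicate]
  refine exists_congr fun j => ?_
  have := hk j
  constructor
  · exact fun h => h.2
  · exact fun h => ⟨by omega, h⟩

theorem aux_sorted {α : Type*} [LinearOrder α] {σ : ℕ} (s : Fin σ → α) (hs : StrictMono s)
    (k : Fin σ → ℕ) : (clustered s k).Pairwise (· ≥ ·) := by
  unfold clustered
  rw [List.pairwise_flatMap]
  constructor
  · intro j _
    rw [List.pairwise_replicate]; right; exact le_rfl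
  · rw [List.pairwise_reverse]
    refine (List.pairwise_lt_finRange σ).imp ?_
    intro a b hab x hx y hy
    rw [List.eq_of_mem_replicate hx, List.eq_of_mem_replicate hy]
    exact (hs hab).le

theorem aux_count {α : Type*} [LinearOrder α] {σ : ℕ} (s : Fin σ → α) (hs : StrictMono s)
    (k : Fin σ → ℕ) (j : Fin σ) : (clustered s k).count (s j) = k j := by
  unfold clustered
  rw [List.count_flatMap]
  have : (List.count (s j) ∘ fun j => List.replicate (k j) (s j)) =
      fun i => if i = j then k i else 0 := by
    funext i
    simp [List.count_replicate, hs.injective.eq_iff]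
  rw [this, List.map_reverse, List.sum_reverse, ← Fin.sum_univ_def]
  simp

theorem aux_runs {α : Type*} [LinearOrder α] {σ : ℕ} (hσ : 1 ≤ σ) (s : Fin σ → α)
    (hs : StrictMono s) (k : Fin σ → ℕ) (hk : ∀ j, 2 ≤ k j) :
    runsCount (bwtL (term (clustered s k))) = σ + 1 := by
  rw [aux_term]
  rw [aux_bwt]
  · have hrev : ((clustered s k).map WithBot.some).reverse =
        (List.finRange σ).flatMap (fun j => List.replicate (k j) ((s j : α) : WithBot α)) := by
      unfold clustered
      rw [List.map_flatMap, List.reverse_flatMap]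
      simp [Function.comp_def]
    rw [hrev]
    obtain ⟨n, rfl⟩ : ∃ n, σ = n + 1 := ⟨σ - 1, by omega⟩
    have hch : ((List.finRange (n+1)).map (fun j => ((s j : α) : WithBot α)) ++ [⊥]).IsChain
        (· ≠ ·) := by
      apply List.Pairwise.isChain
      rw [List.pairwise_append]
      refine ⟨?_, by simp, by simp⟩
      rw [List.pairwise_map]
      refine (List.pairwise_lt_finRange _).imp ?_
      intro a b hab
      simpa using (hs hab).ne
    rw [List.finRange_succ] at hch ⊢
    obtain ⟨m, hm⟩ : ∃ m, k 0 = m + 1 := ⟨k 0 - 1, by have := hk 0; omega⟩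
    unfold runsCount
    rw [List.flatMap_cons, hm, List.replicate_succ, List.cons_append, List.cons_append,
      List.destutter_cons', List.append_assoc, aux_destutter_rep,
      aux_destutter (fun j => ((s j : α) : WithBot α)) k ⊥ (fun j => by have := hk j; omega)]
    · simp
    · simpa using hch
  · intro a ha
    simp only [List.mem_map] at ha
    obtain ⟨b, -, rfl⟩ := ha
    exact WithBot.bot_lt_coe b
  · rw [List.pairwise_map]
    refine (aux_sorted s hs k).imp ?_
    intro a b h
    exact WithBot.coe_le_coe.2 h

theorem aux_chi {α : Type*} [LinearOrder α] {σ : ℕ} (hσ : 1 ≤ σ) (s : Fin σ → α)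
    (hs : StrictMono s) (k : Fin σ → ℕ) (hk : ∀ j, 2 ≤ k j) :
    chi (clustered s k) = 2 * σ := by
  unfold chi
  apply aux_sre σ hσ (Fin.cons ⊥ (fun j => ((s j : α) : WithBot α))) _ k hk
  · rw [aux_term]
    rw [List.pairwise_append]
    refine ⟨?_, by simp, by simp⟩
    rw [List.pairwise_map]
    refine (aux_sorted s hs k).imp ?_
    intro a b h
    exact WithBot.coe_le_coe.2 h
  · intro e
    rw [aux_term]
    rw [Fin.exists_fin_succ]
    simp [aux_mem s k hk, or_comm, eq_comm (a := e)]
  · intro j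
    rw [aux_term]
    rw [Fin.cons_succ, List.count_append,
      List.count_map_of_injective _ WithBot.some WithBot.coe_injective,
      aux_count s hs]
    simp
  · intro i j hij
    induction j using Fin.cases with
    | zero => exact absurd hij (Fin.not_lt_zero _)
    | succ j =>
      induction i using Fin.cases with
      | zero => simp
      | succ i => simpa using hs (Fin.succ_lt_succ_iff.1 hij)

/-- for every σ ≥ 1 and every clustered string K over an ordered
alphabet of size σ with all block exponents ≥ 2, the ratio χ(K)/r(K) equals
2σ/(σ+1); consequently the ratios over the clustered family tend to 2 as
σ → ∞. -/
theorem clustered_ratio :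
    (∀ (α : Type) [LinearOrder α] (σ : ℕ), 1 ≤ σ →
      ∀ (s : Fin σ → α), StrictMono s →
      ∀ (k : Fin σ → ℕ), (∀ j, 2 ≤ k j) →
        (chi (clustered s k) : ℝ) / (runsCount (bwtL (term (clustered s k))) : ℝ)
          = (2 * σ : ℝ) / ((σ : ℝ) + 1)) ∧
    Filter.Tendsto (fun σ : ℕ => (2 * σ : ℝ) / ((σ : ℝ) + 1))
      Filter.atTop (nhds 2) := by
  refine ⟨?_, ?_⟩
  · intro α _ σ hσ s hs k hk
    rw [aux_chi hσ s hs k hk, aux_runs hσ s hs k hk]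
    push_cast
    rfl
  · have h : Filter.Tendsto (fun n : ℕ => (2 : ℝ) * ((n : ℝ) / ((n : ℝ) + 1)))
        Filter.atTop (nhds (2 * 1)) :=
      (tendsto_natCast_div_add_atTop (1 : ℝ)).const_mul 2
    rw [mul_one] at h
    refine h.congr fun n => ?_
    rw [mul_div_assoc]
end
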